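/- Let k ≥ 3 be an integer. For n ≥ 1 let R⁺(n) denote the number of quadruples of positive integers (x_1, x_2, x_3, x_4) with x_1^k + x_2^k + x_3^k + x_4^k = n. Then for every ε > 0 there exists a constant C > 0 such that for all n ≥ 1, R⁺(n) ≤ C · n^{ 9/(4k) + ε }. -/

import Mathlib

/-- The divisor bound: `n` has at most `O(n ^ ε)` divisors. -/
theorem Nat.exists_card_divisors_le_rpow {ε : ℝ} (hε : 0 < ε) :
    ∃ C : ℝ, 0 < C ∧ ∀ n : ℕ, n ≠ 0 → (n.divisors.card : ℝ) ≤ C * (n : ℝ) ^ ε := by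
  have hlog : 0 < Real.log 2 := Real.log_pos (by norm_num)
  set A : ℝ := 1 + 1 / (ε * Real.log 2) with hA
  have hA1 : 1 ≤ A := by
    have : 0 < 1 / (ε * Real.log 2) := by positivity
    linarith
  set P : ℕ := ⌈(2 : ℝ) ^ (1 / ε)⌉₊ with hP
  have small (p e : ℕ) (hp : 2 ≤ p) : ((e : ℝ) + 1) ≤ A * ((p : ℝ) ^ e) ^ ε := by
    have h2 : (2 : ℝ) ≤ p := by exact_mod_cast hp
    have h3 : ((2 : ℝ) ^ e) ^ ε ≤ ((p : ℝ) ^ e) ^ ε := by gcongr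
    have h4 : (e : ℝ) * (ε * Real.log 2) + 1 ≤ ((2 : ℝ) ^ e) ^ ε := by
      rw [Real.rpow_def_of_pos (by positivity), Real.log_pow]
      have := Real.add_one_le_exp ((e : ℝ) * Real.log 2 * ε)
      linarith
    have h5 : (e : ℝ) + 1 ≤ A * ((e : ℝ) * (ε * Real.log 2) + 1) := by
      have h6 : A * ((e : ℝ) * (ε * Real.log 2) + 1)
          = e + 1 + (e : ℝ) * (ε * Real.log 2) + 1 / (ε * Real.log 2) := by
        rw [hA]; field_simp; ring
      have : 0 ≤ 1 / (ε * Real.log 2) := by positivity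
      have : 0 ≤ (e : ℝ) * (ε * Real.log 2) := by positivity
      linarith
    exact h5.trans (mul_le_mul_of_nonneg_left (h4.trans h3) (by linarith))
  have large (p e : ℕ) (hp : P ≤ p) : ((e : ℝ) + 1) ≤ ((p : ℝ) ^ e) ^ ε := by
    have h1 : (2 : ℝ) ^ (1 / ε) ≤ p := (Nat.le_ceil _).trans (by exact_mod_cast hp)
    have h2 : (2 : ℝ) ≤ (p : ℝ) ^ ε := by
      calc (2 : ℝ) = ((2 : ℝ) ^ (1 / ε)) ^ ε := by
            rw [← Real.rpow_mul (by norm_num), one_div_mul_cancel hε.ne', Real.rpow_one]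
        _ ≤ _ := by gcongr
    have h3 : ((p : ℝ) ^ e) ^ ε = ((p : ℝ) ^ ε) ^ e := by
      rw [← Real.rpow_natCast, ← Real.rpow_natCast, ← Real.rpow_mul (by positivity),
        ← Real.rpow_mul (by positivity), mul_comm]
    rw [h3]
    have h4 : ((e : ℝ) + 1) ≤ 2 ^ e := by exact_mod_cast Nat.lt_two_pow_self (n := e)
    exact h4.trans (by gcongr)
  refine ⟨A ^ P, by positivity, fun n hn => ?_⟩
  rw [Nat.card_divisors hn]
  push_cast
  have hprod : (n : ℝ) ^ ε = ∏ p ∈ n.primeFactors, ((p : ℝ) ^ (n.factorization p)) ^ ε := by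
    rw [Real.finsetProd_rpow _ _ (fun _ _ => by positivity)]
    congr 1
    exact_mod_cast (Nat.prod_factorization_pow_eq_self hn).symm
  calc ∏ p ∈ n.primeFactors, ((n.factorization p : ℝ) + 1)
      ≤ ∏ p ∈ n.primeFactors, ((if p < P then A else 1) *
          ((p : ℝ) ^ (n.factorization p)) ^ ε) := by
        refine Finset.prod_le_prod (fun _ _ => by positivity) fun p hp => ?_
        split_ifs with h
        · exact small p _ (Nat.prime_of_mem_primeFactors hp).two_le
        · rw [one_mul]
          exact large p _ (not_lt.mp h)
    _ = (∏ p ∈ n.primeFactors, (if p < P then A else 1)) * (n : ℝ) ^ ε := by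
        rw [Finset.prod_mul_distrib, hprod]
    _ ≤ A ^ P * (n : ℝ) ^ ε := by
        gcongr
        rw [← Finset.prod_filter, Finset.prod_const]
        refine pow_le_pow_right₀ hA1 ?_
        calc (n.primeFactors.filter (· < P)).card ≤ (Finset.range P).card :=
              Finset.card_le_card fun p hp => by simp_all
          _ = P := Finset.card_range P

namespace GaussianInt

/-- The Gaussian integers of norm `n`. -/
def normSphere (n : ℕ) : Set GaussianInt := {z | z.norm = n}

theorem mem_normSphere {n : ℕ} {z : GaussianInt} : z ∈ normSphere n ↔ z.norm = n := Iff.rfl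

theorem mem_normSphere_natAbs {n : ℕ} {z : GaussianInt} :
    z ∈ normSphere n ↔ z.norm.natAbs = n := by
  have := norm_nonneg z
  rw [mem_normSphere]; omega

theorem normSphere_subset (n : ℕ) : normSphere n ⊆
    ((fun q : ℤ × ℤ => (⟨q.1, q.2⟩ : GaussianInt)) ''
      ((Finset.Icc (-n : ℤ) n ×ˢ Finset.Icc (-n : ℤ) n : Finset (ℤ × ℤ)) : Set (ℤ × ℤ))) := by
  intro z hz
  rw [mem_normSphere, Zsqrtd.norm_def] at hz
  refine ⟨(z.re, z.im), ?_, rfl⟩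
  simp only [Finset.coe_product, Finset.coe_Icc, Set.mem_prod, Set.mem_Icc]
  refine ⟨⟨?_, ?_⟩, ?_, ?_⟩ <;> nlinarith [sq_nonneg z.re, sq_nonneg z.im]

theorem finite_normSphere (n : ℕ) : (normSphere n).Finite :=
  ((Finset.finite_toSet _).image _).subset (normSphere_subset n)

theorem ncard_normSphere_one_le : (normSphere 1).ncard ≤ 9 := by
  refine (Set.ncard_le_ncard (normSphere_subset 1) ((Finset.finite_toSet _).image _)).trans ?_
  refine (Set.ncard_image_le (Finset.finite_toSet _)).trans ?_
  rw [Set.ncard_coe_finset]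
  decide

theorem dvd_of_mem_normSphere {n : ℕ} {z : GaussianInt} (hz : z ∈ normSphere n) :
    z ∣ (n : GaussianInt) := by
  refine ⟨star z, ?_⟩
  rw [← Zsqrtd.norm_eq_mul_conj, mem_normSphere.mp hz]
  simp

theorem normSphere_mul_subset {a b : ℕ} (h : a.Coprime b) :
    normSphere (a * b) ⊆ Set.image2 (· * ·) (normSphere a) (normSphere b) := by
  intro z hz
  have hd := dvd_of_mem_normSphere hz
  push_cast at hd
  obtain ⟨w, u, hw, hu, rfl⟩ := exists_dvd_and_dvd_of_dvd_mul hd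
  rw [mem_normSphere_natAbs, Zsqrtd.norm_mul, Int.natAbs_mul] at hz
  have key (c : ℕ) (v : GaussianInt) (hv : v ∣ (c : GaussianInt)) : v.norm.natAbs ∣ c * c := by
    obtain ⟨t, ht⟩ := hv
    have := congrArg (fun x : GaussianInt => x.norm.natAbs) ht
    simp only [Zsqrtd.norm_natCast, Zsqrtd.norm_mul, Int.natAbs_mul, Int.natAbs_natCast] at this
    exact ⟨_, this⟩
  have hwb : (w.norm.natAbs).Coprime b :=
    Nat.Coprime.coprime_dvd_left (key a w hw) (h.mul_left h)
  have hua : (u.norm.natAbs).Coprime a :=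
    Nat.Coprime.coprime_dvd_left (key b u hu) (h.symm.mul_left h.symm)
  have hwa : w.norm.natAbs ∣ a := hwb.dvd_of_dvd_mul_right ⟨_, hz.symm⟩
  have haw : a ∣ w.norm.natAbs := hua.symm.dvd_of_dvd_mul_right ⟨_, hz⟩
  have hub : u.norm.natAbs ∣ b :=
    hua.dvd_of_dvd_mul_left ⟨w.norm.natAbs, by rw [← hz, mul_comm]⟩
  have hbu : b ∣ u.norm.natAbs :=
    hwb.symm.dvd_of_dvd_mul_left ⟨a, by rw [hz, mul_comm]⟩
  exact ⟨w, mem_normSphere_natAbs.mpr (Nat.dvd_antisymm hwa haw),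
    u, mem_normSphere_natAbs.mpr (Nat.dvd_antisymm hub hbu), rfl⟩

theorem ncard_normSphere_mul_le {a b : ℕ} (h : a.Coprime b) :
    (normSphere (a * b)).ncard ≤ (normSphere a).ncard * (normSphere b).ncard := by
  refine (Set.ncard_le_ncard (normSphere_mul_subset h)
    ((finite_normSphere a).image2 _ (finite_normSphere b))).trans ?_
  rw [← Set.image_prod, ← Set.ncard_prod]
  exact Set.ncard_image_le ((finite_normSphere a).prod (finite_normSphere b))

theorem isUnit_iff_mem_normSphere {u : GaussianInt} : IsUnit u ↔ u ∈ normSphere 1 := by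
  rw [mem_normSphere_natAbs, Zsqrtd.norm_eq_one_iff]

theorem setOf_dvd_pow_subset {q : GaussianInt} (hq : Prime q ∨ q = 1) (e : ℕ) :
    {w | w ∣ q ^ e} ⊆
      Set.image2 (fun u j => u * q ^ j) (normSphere 1) (Finset.range (e + 1) : Set ℕ) := by
  intro w hw
  rcases hq with hq | rfl
  · obtain ⟨i, hi, u, hu⟩ := (dvd_prime_pow hq e).mp hw
    refine ⟨↑u⁻¹, isUnit_iff_mem_normSphere.mp (Units.isUnit _), i, by simp; omega, ?_⟩
    simp only
    rw [← hu, mul_comm w, Units.inv_mul_cancel_left]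
  · refine ⟨w, isUnit_iff_mem_normSphere.mp ?_, 0, by simp, by simp⟩
    simpa [isUnit_iff_dvd_one] using hw

theorem ncard_setOf_dvd_pow_le {q : GaussianInt} (hq : Prime q ∨ q = 1) (e : ℕ) :
    {w | w ∣ q ^ e}.Finite ∧ {w | w ∣ q ^ e}.ncard ≤ 9 * (e + 1) := by
  have hf : ((normSphere 1) ×ˢ (Finset.range (e + 1) : Set ℕ)).Finite :=
    (finite_normSphere 1).prod (Finset.finite_toSet _)
  have hs := setOf_dvd_pow_subset hq e
  rw [← Set.image_prod] at hs
  refine ⟨(hf.image _).subset hs, ?_⟩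
  refine (Set.ncard_le_ncard hs (hf.image _)).trans ((Set.ncard_image_le hf).trans ?_)
  rw [Set.ncard_prod, Set.ncard_coe_finset, Finset.card_range]
  exact Nat.mul_le_mul_right _ ncard_normSphere_one_le

theorem prime_of_norm_natAbs_prime {z : GaussianInt} (hz : z.norm.natAbs.Prime) : Prime z := by
  rw [← irreducible_iff_prime]
  refine ⟨fun h => ?_, fun a b hab => ?_⟩
  · rw [← Zsqrtd.norm_eq_one_iff] at h
    exact hz.one_lt.ne' h
  · rw [hab, Zsqrtd.norm_mul, Int.natAbs_mul, Nat.prime_mul_iff] at hz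
    rcases hz with h | h
    · exact Or.inr (Zsqrtd.norm_eq_one_iff.mp h.2)
    · exact Or.inl (Zsqrtd.norm_eq_one_iff.mp h.2)

theorem exists_natCast_prime_eq_mul {p : ℕ} (hp : p.Prime) :
    ∃ q₁ q₂ : GaussianInt, (Prime q₁ ∨ q₁ = 1) ∧ (Prime q₂ ∨ q₂ = 1) ∧ (p : GaussianInt) = q₁ * q₂ := by
  have := Fact.mk hp
  by_cases h : Irreducible (p : GaussianInt)
  · exact ⟨p, 1, Or.inl h.prime, Or.inr rfl, by simp⟩
  · obtain ⟨a, b, hab⟩ := sq_add_sq_of_nat_prime_of_not_irreducible p h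
    have hn : (⟨a, b⟩ : GaussianInt).norm = p := by
      rw [Zsqrtd.norm_def, ← hab]; push_cast; ring
    refine ⟨⟨a, b⟩, star ⟨a, b⟩, Or.inl (prime_of_norm_natAbs_prime ?_),
      Or.inl (prime_of_norm_natAbs_prime ?_), ?_⟩
    · rwa [hn, Int.natAbs_natCast]
    · rwa [Zsqrtd.norm_conj, hn, Int.natAbs_natCast]
    · rw [← Zsqrtd.norm_eq_mul_conj, hn]; simp

theorem ncard_normSphere_prime_pow_le {p : ℕ} (hp : p.Prime) {e : ℕ} (he : 0 < e) :
    (normSphere (p ^ e)).ncard ≤ (e + 1) ^ 10 := by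
  obtain ⟨q₁, q₂, h₁, h₂, h⟩ := exists_natCast_prime_eq_mul hp
  obtain ⟨f₁, c₁⟩ := ncard_setOf_dvd_pow_le h₁ e
  obtain ⟨f₂, c₂⟩ := ncard_setOf_dvd_pow_le h₂ e
  have hs : normSphere (p ^ e) ⊆
      Set.image2 (· * ·) {w | w ∣ q₁ ^ e} {w | w ∣ q₂ ^ e} := by
    intro z hz
    have hd := dvd_of_mem_normSphere hz
    push_cast at hd
    rw [h, mul_pow] at hd
    obtain ⟨w, u, hw, hu, rfl⟩ := exists_dvd_and_dvd_of_dvd_mul hd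
    exact ⟨w, hw, u, hu, rfl⟩
  rw [← Set.image_prod] at hs
  have h9 : 9 ≤ (e + 1) ^ 4 :=
    (by norm_num : 9 ≤ 2 ^ 4).trans (Nat.pow_le_pow_left (by omega) 4)
  calc (normSphere (p ^ e)).ncard
      ≤ ({w | w ∣ q₁ ^ e} ×ˢ {w | w ∣ q₂ ^ e}).ncard :=
        (Set.ncard_le_ncard hs ((f₁.prod f₂).image _)).trans (Set.ncard_image_le (f₁.prod f₂))
    _ ≤ (9 * (e + 1)) * (9 * (e + 1)) := by
        rw [Set.ncard_prod]; exact Nat.mul_le_mul c₁ c₂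
    _ ≤ ((e + 1) ^ 4 * (e + 1)) * ((e + 1) ^ 4 * (e + 1)) := by gcongr
    _ = (e + 1) ^ 10 := by ring

theorem ncard_normSphere_le {n : ℕ} (hn : n ≠ 0) :
    (normSphere n).ncard ≤ 9 * n.divisors.card ^ 10 := by
  have key (n : ℕ) : 1 < n → (normSphere n).ncard ≤ n.divisors.card ^ 10 := by
    induction n using Nat.recOnPosPrimePosCoprime with
    | zero => omega
    | one => omega
    | prime_pow p e hp he =>
      intro _
      rw [Nat.divisors_prime_pow hp, Finset.card_map, Finset.card_range]
      exact ncard_normSphere_prime_pow_le hp he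
    | coprime a b ha hb hab iha ihb =>
      intro _
      rw [hab.card_divisors_mul, mul_pow]
      exact (ncard_normSphere_mul_le hab).trans (Nat.mul_le_mul (iha ha) (ihb hb))
  rcases eq_or_ne n 1 with rfl | h
  · simpa using ncard_normSphere_one_le
  · exact (key n (by omega)).trans (Nat.le_mul_of_pos_left _ (by norm_num))

end GaussianInt

/-- The pairs of positive integers whose `k`-th powers sum to `m`. -/
def powPairs (k m : ℕ) : Finset (ℕ × ℕ) :=
  (Finset.Icc 1 m ×ˢ Finset.Icc 1 m).filter fun q => q.1 ^ k + q.2 ^ k = m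

theorem mem_powPairs {k m : ℕ} (hk : k ≠ 0) {q : ℕ × ℕ} :
    q ∈ powPairs k m ↔ 0 < q.1 ∧ 0 < q.2 ∧ q.1 ^ k + q.2 ^ k = m := by
  have h₁ := Nat.le_self_pow hk q.1
  have h₂ := Nat.le_self_pow hk q.2
  simp only [powPairs, Finset.mem_filter, Finset.mem_product, Finset.mem_Icc]
  constructor
  · rintro ⟨⟨⟨_, _⟩, _, _⟩, h⟩
    exact ⟨by omega, by omega, h⟩
  · rintro ⟨_, _, h⟩
    exact ⟨⟨⟨by omega, by omega⟩, by omega, by omega⟩, h⟩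

theorem card_powPairs_le_of_even {k m : ℕ} (hk : k ≠ 0) (he : Even k) :
    (powPairs k m).card ≤ (GaussianInt.normSphere m).ncard := by
  obtain ⟨j, rfl⟩ := he
  have hj : j ≠ 0 := by omega
  rw [← Set.ncard_coe_finset]
  refine Set.ncard_le_ncard_of_injOn
    (fun q => (⟨(q.1 ^ j : ℕ), (q.2 ^ j : ℕ)⟩ : GaussianInt)) ?_ ?_
    (GaussianInt.finite_normSphere m)
  · intro q hq
    obtain ⟨_, _, h⟩ := (mem_powPairs hk).mp hq
    rw [GaussianInt.mem_normSphere, Zsqrtd.norm_def, ← h]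
    push_cast
    ring
  · intro q _ r _ h
    have h₁ : q.1 ^ j = r.1 ^ j := Nat.cast_injective (R := ℤ) (congrArg Zsqrtd.re h)
    have h₂ : q.2 ^ j = r.2 ^ j := Nat.cast_injective (R := ℤ) (congrArg Zsqrtd.im h)
    exact Prod.ext (Nat.pow_left_injective hj h₁) (Nat.pow_left_injective hj h₂)

theorem Nat.pow_add_pow_lt {k x y : ℕ} (hk : 1 < k) (hx : 0 < x) (hy : 0 < y) :
    x ^ k + y ^ k < (x + y) ^ k := by
  obtain ⟨j, rfl⟩ := Nat.exists_eq_add_of_lt hk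
  have h₁ : x ^ (1 + j) < (x + y) ^ (1 + j) := Nat.pow_lt_pow_left (by omega) (by omega)
  have h₂ : y ^ (1 + j) < (x + y) ^ (1 + j) := Nat.pow_lt_pow_left (by omega) (by omega)
  rw [pow_succ, pow_succ, pow_succ, mul_add]
  gcongr

open Polynomial in
theorem card_powPairs_filter_add_le {k : ℕ} (hk : 1 < k) (m s : ℕ) :
    ((powPairs k m).filter fun q => q.1 + q.2 = s).card ≤ k := by
  have hk0 : k ≠ 0 := by omega
  rcases Finset.eq_empty_or_nonempty ((powPairs k m).filter fun q => q.1 + q.2 = s) with h | ⟨q, hq⟩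
  · simp [h]
  rw [Finset.mem_filter, mem_powPairs hk0] at hq
  obtain ⟨⟨hq₁, hq₂, hqm⟩, hqs⟩ := hq
  set f : ℤ[X] := X ^ k + (C (s : ℤ) - X) ^ k - C (m : ℤ) with hf
  have hlt : m < s ^ k := by
    rw [← hqm, ← hqs]
    exact Nat.pow_add_pow_lt hk hq₁ hq₂
  have hf0 : f ≠ 0 := by
    intro h0
    have h1 : f.eval 0 = 0 := by rw [h0, eval_zero]
    simp [hf, hk0] at h1
    have : ((s ^ k : ℕ) : ℤ) = m := by push_cast; linarith
    norm_cast at this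
    omega
  have hdeg : f.natDegree ≤ k := by
    rw [hf]
    compute_degree
  calc _ ≤ f.roots.toFinset.card := by
        refine Finset.card_le_card_of_injOn (fun q => (q.1 : ℤ)) ?_ ?_
        · intro r hr
          rw [Finset.mem_coe, Finset.mem_filter, mem_powPairs hk0] at hr
          obtain ⟨⟨_, _, hrm⟩, hrs⟩ := hr
          rw [Finset.mem_coe, Multiset.mem_toFinset, mem_roots hf0, IsRoot.def]
          simp only [hf, eval_sub, eval_add, eval_pow, eval_X, eval_C, ← hrm, ← hrs]
          push_cast
          ring
        · intro r hr t ht h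
          rw [Finset.mem_coe, Finset.mem_filter] at hr ht
          have h' : r.1 = t.1 := Nat.cast_injective (R := ℤ) h
          exact Prod.ext h' (by omega)
    _ ≤ f.natDegree := (Multiset.toFinset_card_le _).trans (card_roots' f)
    _ ≤ k := hdeg

theorem card_powPairs_le_of_odd {k m : ℕ} (hk : 1 < k) (ho : Odd k) (hm : m ≠ 0) :
    (powPairs k m).card ≤ k * m.divisors.card := by
  refine Finset.card_le_mul_card_image_of_maps_to (f := fun q => q.1 + q.2) (fun q hq => ?_) k
    fun s _ => card_powPairs_filter_add_le hk m s
  obtain ⟨_, _, h⟩ := (mem_powPairs (by omega)).mp hq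
  rw [Nat.mem_divisors]
  exact ⟨h ▸ ho.nat_add_dvd_pow_add_pow q.1 q.2, hm⟩

theorem card_powPairs_le {k m : ℕ} (hk : 1 < k) (hm : m ≠ 0) :
    (powPairs k m).card ≤ 9 * k * m.divisors.card ^ 10 := by
  rcases Nat.even_or_odd k with h | h
  · refine (card_powPairs_le_of_even (by omega) h).trans
      ((GaussianInt.ncard_normSphere_le hm).trans ?_)
    exact Nat.mul_le_mul_right _ (by omega)
  · refine (card_powPairs_le_of_odd hk h hm).trans ?_
    exact Nat.mul_le_mul (by omega) (Nat.le_self_pow (by norm_num) _)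

theorem exists_card_powPairs_le_rpow {k : ℕ} (hk : 1 < k) {ε : ℝ} (hε : 0 < ε) :
    ∃ C : ℝ, 0 < C ∧ ∀ m : ℕ, ((powPairs k m).card : ℝ) ≤ C * (m : ℝ) ^ ε := by
  obtain ⟨C, hC, h⟩ := Nat.exists_card_divisors_le_rpow (ε := ε / 10) (by positivity)
  refine ⟨9 * k * C ^ 10, by positivity, fun m => ?_⟩
  rcases eq_or_ne m 0 with rfl | hm
  · simp [powPairs, Real.zero_rpow hε.ne']
  calc ((powPairs k m).card : ℝ) ≤ 9 * k * (m.divisors.card : ℝ) ^ 10 := by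
        exact_mod_cast card_powPairs_le hk hm
    _ ≤ 9 * k * (C * (m : ℝ) ^ (ε / 10)) ^ 10 := by
        gcongr
        exact h m hm
    _ = 9 * k * C ^ 10 * (m : ℝ) ^ ε := by
        rw [mul_pow, ← Real.rpow_natCast ((m : ℝ) ^ (ε / 10)), ← Real.rpow_mul (by positivity)]
        norm_num
        ring

theorem stmt_16 (k : ℕ) (hk : 3 ≤ k) :
    ∀ ε : ℝ, 0 < ε → ∃ C : ℝ, 0 < C ∧ ∀ n : ℕ, 1 ≤ n →
      (({x : ℕ × ℕ × ℕ × ℕ | 0 < x.1 ∧ 0 < x.2.1 ∧ 0 < x.2.2.1 ∧ 0 < x.2.2.2 ∧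
            x.1 ^ k + x.2.1 ^ k + x.2.2.1 ^ k + x.2.2.2 ^ k = n}.ncard : ℝ)) ≤
        C * (n : ℝ) ^ (9 / (4 * (k : ℝ)) + ε) := by
  intro ε hε
  have hk0 : k ≠ 0 := by omega
  obtain ⟨C, hC, h⟩ := exists_card_powPairs_le_rpow (k := k) (by omega) hε
  refine ⟨C, hC, fun n hn => ?_⟩
  set N : ℕ := ⌊(n : ℝ) ^ (1 / (k : ℝ))⌋₊ with hN
  have hle (x : ℕ) (hx : x ^ k ≤ n) : x ≤ N := by
    refine Nat.le_floor ?_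
    calc (x : ℝ) = ((x : ℝ) ^ k) ^ (1 / (k : ℝ)) := by
          rw [one_div, Real.pow_rpow_inv_natCast (by positivity) hk0]
      _ ≤ _ := by
          gcongr
          exact_mod_cast hx
  have hn1 : (1 : ℝ) ≤ n := by exact_mod_cast hn
  set B := Finset.Icc 1 N ×ˢ Finset.Icc 1 N with hB
  set F : Finset (Σ _ : ℕ × ℕ, ℕ × ℕ) :=
    B.sigma fun b => powPairs k (n - b.1 ^ k - b.2 ^ k) with hF
  have hcard : {x : ℕ × ℕ × ℕ × ℕ | 0 < x.1 ∧ 0 < x.2.1 ∧ 0 < x.2.2.1 ∧ 0 < x.2.2.2 ∧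
      x.1 ^ k + x.2.1 ^ k + x.2.2.1 ^ k + x.2.2.2 ^ k = n}.ncard ≤ F.card := by
    rw [← Set.ncard_coe_finset F]
    refine Set.ncard_le_ncard_of_injOn (fun x => ⟨(x.1, x.2.1), (x.2.2.1, x.2.2.2)⟩) ?_ ?_
      (Finset.finite_toSet F)
    · rintro ⟨a, b, c, d⟩ ⟨ha, hb, hc, hd, hs⟩
      simp only at ha hb hc hd hs
      simp only [hF, hB, Finset.mem_coe, Finset.mem_sigma, Finset.mem_product, Finset.mem_Icc,
        mem_powPairs hk0]
      exact ⟨⟨⟨ha, hle a (by omega)⟩, hb, hle b (by omega)⟩, hc, hd, by omega⟩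
    · rintro ⟨a, b, c, d⟩ _ ⟨a', b', c', d'⟩ _ h
      simp only [Sigma.mk.injEq, Prod.mk.injEq, heq_eq_eq] at h
      obtain ⟨⟨rfl, rfl⟩, rfl, rfl⟩ := h
      rfl
  calc _ ≤ (F.card : ℝ) := by exact_mod_cast hcard
    _ = ∑ b ∈ B, ((powPairs k (n - b.1 ^ k - b.2 ^ k)).card : ℝ) := by
        rw [hF, Finset.card_sigma]
        push_cast
        rfl
    _ ≤ ∑ b ∈ B, C * (n : ℝ) ^ ε := by
        refine Finset.sum_le_sum fun b _ => (h _).trans ?_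
        gcongr
        omega
    _ = (N : ℝ) ^ 2 * (C * (n : ℝ) ^ ε) := by
        rw [Finset.sum_const, nsmul_eq_mul, hB, Finset.card_product, Nat.card_Icc]
        push_cast [Nat.add_sub_cancel]
        ring
    _ ≤ ((n : ℝ) ^ (1 / (k : ℝ))) ^ 2 * (C * (n : ℝ) ^ ε) := by
        gcongr
        exact Nat.floor_le (by positivity)
    _ = C * (n : ℝ) ^ (2 / (k : ℝ) + ε) := by
        rw [Real.rpow_add (by positivity), ← Real.rpow_natCast ((n : ℝ) ^ (1 / (k : ℝ))),
          ← Real.rpow_mul (by positivity)]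
        push_cast
        rw [show 1 / (k : ℝ) * 2 = 2 / k by ring]
        ring
    _ ≤ C * (n : ℝ) ^ (9 / (4 * (k : ℝ)) + ε) := by
        have hk' : (0 : ℝ) < k := by positivity
        have he : 2 / (k : ℝ) ≤ 9 / (4 * k) := by
          rw [div_le_div_iff₀ (by positivity) (by positivity)]
          linarith
        exact mul_le_mul_of_nonneg_left (Real.rpow_le_rpow_of_exponent_le hn1 (by linarith)) hC.le
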